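/- arXiv:2401.12190 — 5 statements merged into one kernel-verified Lean document; each statement's English description precedes it below -/
import Mathlib

section
/- For every integer n ≥ 3 and every real ρ ∈ (-1,1), the function f_{n,ρ} integrates to one: ∫_{-1}^{1} f_{n,ρ}(r) dr = 1, i.e. f_{n,ρ} is a probability density on ℝ. -/
open MeasureTheory Real

/-- Fisher's density of the sample correlation coefficient of a size-`n` sample from a
bivariate normal distribution with population correlation `ρ`. -/
noncomputable def fisherDensity (n : ℕ) (ρ : ℝ) (r : ℝ) : ℝ :=
  if |r| < 1 then
    (2 ^ ((n : ℝ) - 3) * (1 - ρ ^ 2) ^ (((n : ℝ) - 1) / 2) *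
        (1 - r ^ 2) ^ (((n : ℝ) - 4) / 2) / (π * Gamma ((n : ℝ) - 2))) *
      ∑' k : ℕ, (Gamma (((n : ℝ) - 1 + (k : ℝ)) / 2)) ^ 2 * (2 * r * ρ) ^ k / (Nat.factorial k : ℝ)
  else 0


lemma fd_beta_integral {u v : ℝ} (hu : 0 < u) (hv : 0 < v) :
    ∫ x in Set.Ioi (0:ℝ), ProbabilityTheory.betaPDFReal u v x = 1 := by
  have h1 : ∫ x, ProbabilityTheory.betaPDFReal u v x = 1 := by
    rw [integral_eq_lintegral_of_nonneg_ae]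
    · have := ProbabilityTheory.lintegral_betaPDF_eq_one hu hv
      unfold ProbabilityTheory.betaPDF at this
      rw [this]; simp
    · refine Filter.Eventually.of_forall fun x => ?_
      unfold ProbabilityTheory.betaPDFReal
      have := ProbabilityTheory.beta_pos hu hv
      simp only [Pi.zero_apply]
      split_ifs with h
      · have : 0 < 1 - x := by linarith [h.2]
        have := h.1
        positivity
      · exact le_rfl
    · exact (ProbabilityTheory.measurable_betaPDFReal u v).aestronglyMeasurable
  rw [← h1, setIntegral_eq_integral_of_forall_compl_eq_zero]
  intro x hx
  unfold ProbabilityTheory.betaPDFReal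
  rw [if_neg]
  simp at hx
  intro h; linarith [h.1]

lemma fd_absmoment (b : ℝ) (hb : 0 < b) (k : ℕ) :
    ∫ x : ℝ, (if |x| < 1 then |x| ^ k * (1 - x ^ 2) ^ (b - 1) else 0)
      = Gamma (((k:ℝ) + 1) / 2) * Gamma b / Gamma (((k:ℝ) + 1) / 2 + b) := by
  have h0 := integral_comp_abs (f := fun y : ℝ => if y < 1 then y ^ k * (1 - y ^ 2) ^ (b - 1) else 0)
  simp only [sq_abs] at h0
  rw [h0]
  have hu : 0 < ((k:ℝ) + 1) / 2 := by positivity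
  have hB := ProbabilityTheory.beta_pos hu hb
  have h2 := integral_comp_rpow_Ioi_of_pos (g := ProbabilityTheory.betaPDFReal (((k:ℝ) + 1) / 2) b)
    (p := 2) two_pos
  rw [fd_beta_integral hu hb] at h2
  change _ = ProbabilityTheory.beta (((k:ℝ) + 1) / 2) b
  have h3 := congrArg (fun z => ProbabilityTheory.beta (((k:ℝ) + 1) / 2) b * z) h2
  simp only [mul_one] at h3
  rw [← h3, ← integral_const_mul, ← integral_const_mul]
  refine setIntegral_congr_fun measurableSet_Ioi fun y hy => ?_
  have hy : 0 < y := hy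
  simp only [ProbabilityTheory.betaPDFReal, smul_eq_mul]
  have e2 : y ^ (2:ℝ) = y ^ 2 := by norm_cast
  rw [e2]
  by_cases h : y < 1
  · have : 0 < y ^ 2 ∧ y ^ 2 < 1 := ⟨by positivity, by nlinarith⟩
    rw [if_pos h, if_pos this]
    have e3 : (y^2) ^ (((k:ℝ)+1)/2 - 1) * y = y ^ k := by
      rw [← rpow_natCast y 2, ← rpow_mul hy.le, ← rpow_add_one hy.ne', ← rpow_natCast]
      congr 1; push_cast; ring
    have e4 : y ^ ((2:ℝ) - 1) = y := by norm_num
    rw [← e3, e4]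
    field_simp
  · have : ¬ (0 < y ^ 2 ∧ y ^ 2 < 1) := by
      intro h'; nlinarith [h'.2]
    rw [if_neg h, if_neg this]; simp

lemma fd_meas (b : ℝ) (k : ℕ) :
    Measurable (fun x : ℝ => if |x| < 1 then x ^ k * (1 - x ^ 2) ^ (b - 1) else 0) := by
  refine Measurable.ite (measurableSet_lt (by fun_prop) (by fun_prop)) (by fun_prop) (by fun_prop)

lemma fd_norm (b : ℝ) (k : ℕ) (x : ℝ) :
    ‖(if |x| < 1 then x ^ k * (1 - x ^ 2) ^ (b - 1) else 0 : ℝ)‖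
     = if |x| < 1 then |x| ^ k * (1 - x ^ 2) ^ (b - 1) else 0 := by
  split_ifs with h
  · have : 0 ≤ 1 - x ^ 2 := by nlinarith [abs_nonneg x, sq_abs x]
    rw [norm_mul, norm_pow, Real.norm_eq_abs, Real.norm_eq_abs, abs_of_nonneg (rpow_nonneg this _)]
  · simp

lemma fd_integrable (b : ℝ) (hb : 0 < b) (k : ℕ) :
    Integrable (fun x : ℝ => if |x| < 1 then x ^ k * (1 - x ^ 2) ^ (b - 1) else 0) := by
  rw [← integrable_norm_iff (fd_meas b k).aestronglyMeasurable]
  simp only [fd_norm]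
  refine Integrable.of_integral_ne_zero ?_
  rw [fd_absmoment b hb]
  have h1 : 0 < ((k:ℝ) + 1) / 2 := by positivity
  exact (ProbabilityTheory.beta_pos h1 hb).ne'

lemma fd_odd (b : ℝ) (k : ℕ) :
    ∫ x : ℝ, (if |x| < 1 then x ^ (2*k+1) * (1 - x ^ 2) ^ (b - 1) else 0) = 0 := by
  have := integral_neg_eq_self
    (fun x : ℝ => if |x| < 1 then x ^ (2*k+1) * (1 - x ^ 2) ^ (b - 1) else 0) volume
  have h2 : ∀ x : ℝ, (if |-x| < 1 then (-x) ^ (2*k+1) * (1 - (-x) ^ 2) ^ (b - 1) else 0)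
     = -(if |x| < 1 then x ^ (2*k+1) * (1 - x ^ 2) ^ (b - 1) else 0) := by
    intro x
    rw [abs_neg, neg_sq, (show Odd (2*k+1) from ⟨k, rfl⟩).neg_pow]
    split_ifs <;> ring
  simp only [h2, integral_neg] at this
  linarith

lemma fd_even (b : ℝ) (hb : 0 < b) (k : ℕ) :
    ∫ x : ℝ, (if |x| < 1 then x ^ (2*k) * (1 - x ^ 2) ^ (b - 1) else 0)
     = Gamma (((2*k:ℕ):ℝ) / 2 + 1/2) * Gamma b / Gamma (((2*k:ℕ):ℝ) / 2 + 1/2 + b) := by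
  rw [← add_div, ← fd_absmoment b hb]
  simp only [(even_two_mul k).pow_abs]

lemma fd_fact (k : ℕ) :
    (k.factorial : ℝ) = Gamma ((k:ℝ)/2+1/2) * Gamma ((k:ℝ)/2+1) * 2 ^ k / √π := by
  have h := Gamma_mul_Gamma_add_half ((k:ℝ)/2+1/2)
  have e : (k:ℝ)/2+1/2+1/2 = (k:ℝ)/2+1 := by ring
  have e2 : 2*((k:ℝ)/2+1/2) = k + 1 := by ring
  have e3 : (1:ℝ) - (k + 1) = -k := by ring
  rw [e, e2, e3, Gamma_nat_eq_factorial, rpow_neg two_pos.le, rpow_natCast] at h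
  rw [h]
  have := sqrt_pos.2 pi_pos
  field_simp

lemma fd_gamma_asc (a : ℝ) (ha : 0 < a) (m : ℕ) :
    Gamma (a + m) = Gamma a * (ascPochhammer ℝ m).eval a := by
  induction m with
  | zero => simp
  | succ m ih =>
    rw [ascPochhammer_succ_eval, ← mul_assoc, ← ih]
    push_cast
    rw [← add_assoc, Gamma_add_one (by positivity)]
    ring

lemma fd_congr {f g : ℕ → ℝ} {s t : ℝ} (h : HasSum f s) (hfg : ∀ m, g m = f m)
    (hst : t = s) : HasSum g t := by
  rw [hst, funext hfg]; exact h

lemma fd_binom (a x : ℝ) (ha : 0 < a) (hx : |x| < 1) :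
    HasSum (fun m : ℕ => Gamma (a + m) / m.factorial * x ^ m) (Gamma a * (1 - x) ^ (-a)) := by
  have h := (one_div_one_sub_rpow_hasFPowerSeriesOnBall_zero a).hasSum (y := x)
    (by simpa [enorm_eq_nnnorm] using! hx)
  have h2 := h.mul_left (Gamma a)
  have h1x : 0 ≤ 1 - x := by linarith [le_abs_self x]
  refine (fd_congr h2 ?_ ?_)
  · intro m
    have := Ring.factorial_nsmul_multichoose_eq_ascPochhammer a m
    rw [Ring.multichoose_eq, Polynomial.ascPochhammer_smeval_eq_eval, nsmul_eq_mul] at this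
    rw [fd_gamma_asc a ha, ← this]
    have : (m.factorial : ℝ) ≠ 0 := by positivity
    simp
    field_simp
  · rw [zero_add, rpow_neg h1x, one_div]

lemma fd_summ (p q x : ℝ) (hp : 0 < p) (hq : 0 < q) (hx : |x| < 1) :
    Summable (fun m : ℕ => Gamma (p + m) / Gamma (q + m) * x ^ m) := by
  rcases eq_or_ne x 0 with rfl | h0
  · refine summable_of_ne_finset_zero (s := {0}) fun m hm => ?_
    simp at hm
    simp [hm]
  have G : ∀ r : ℝ, 0 < r → ∀ m : ℕ, 0 < Gamma (r + m) := fun r hr m =>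
    Gamma_pos_of_pos (by positivity)
  refine summable_of_ratio_test_tendsto_lt_one (l := 1 * |x|) (by simpa) ?_ ?_
  · refine Filter.Eventually.of_forall fun m => ?_
    exact mul_ne_zero (div_pos (G p hp m) (G q hq m)).ne' (pow_ne_zero _ h0)
  · have : ∀ m : ℕ, ‖Gamma (p + (m+1:ℕ)) / Gamma (q + (m+1:ℕ)) * x ^ (m+1)‖ /
       ‖Gamma (p + m) / Gamma (q + m) * x ^ m‖ = (1 + (p - q) / (q + m)) * |x| := by
      intro m
      have h1 := G p hp m
      have h2 := G q hq m
      have h1' := G p hp (m+1)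
      have h2' := G q hq (m+1)
      simp only [norm_mul, norm_div, norm_pow, Real.norm_eq_abs]
      rw [abs_of_pos h1, abs_of_pos h2, abs_of_pos h1', abs_of_pos h2']
      push_cast
      rw [← add_assoc, ← add_assoc, Gamma_add_one (by positivity), Gamma_add_one (by positivity)]
      have := abs_pos.2 h0
      have : 0 < q + m := by positivity
      field_simp
      ring
    simp only [this]
    refine Filter.Tendsto.mul_const _ ?_
    have : Filter.Tendsto (fun m : ℕ => (p - q) / (q + m)) Filter.atTop (nhds 0) :=
      Filter.Tendsto.div_atTop tendsto_const_nhds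
        (Filter.tendsto_atTop_add_const_left _ _ tendsto_natCast_atTop_atTop)
    simpa using this.const_add 1


lemma fd_term (n : ℕ) (hn : 3 ≤ n) (x : ℝ) (k : ℕ) :
    (Gamma (((n : ℝ) - 1 + (k : ℝ)) / 2)) ^ 2 * (2 * x) ^ k / (Nat.factorial k : ℝ) *
      (Gamma ((k:ℝ) / 2 + 1/2) * Gamma (((n:ℝ)-2)/2) / Gamma ((k:ℝ) / 2 + 1/2 + ((n:ℝ)-2)/2))
    = √π * Gamma (((n:ℝ)-2)/2) *
      (Gamma (((n:ℝ)-1)/2 + (k:ℝ)/2) / Gamma ((k:ℝ)/2 + 1) * x ^ k) := by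
  have hn' : (3:ℝ) ≤ n := by exact_mod_cast hn
  have e1 : ((n : ℝ) - 1 + (k : ℝ)) / 2 = ((n:ℝ)-1)/2 + (k:ℝ)/2 := by ring
  have e2 : (k:ℝ) / 2 + 1/2 + ((n:ℝ)-2)/2 = ((n:ℝ)-1)/2 + (k:ℝ)/2 := by ring
  rw [e1, e2, fd_fact]
  have hk : (0:ℝ) ≤ k := by positivity
  have g1 : 0 < Gamma (((n:ℝ)-1)/2 + (k:ℝ)/2) := Gamma_pos_of_pos (by linarith)
  have g2 : 0 < Gamma ((k:ℝ) / 2 + 1/2) := Gamma_pos_of_pos (by positivity)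
  have g3 : 0 < Gamma ((k:ℝ) / 2 + 1) := Gamma_pos_of_pos (by positivity)
  have := sqrt_pos.2 pi_pos
  generalize Gamma (((n:ℝ)-1)/2 + (k:ℝ)/2) = A at *
  generalize Gamma ((k:ℝ) / 2 + 1/2) = B at *
  generalize Gamma ((k:ℝ) / 2 + 1) = D at *
  rw [mul_pow]
  field_simp

lemma fd_summ_all (a x : ℝ) (ha : 0 < a) (hx0 : 0 ≤ x) (hx : x < 1) :
    Summable (fun k : ℕ => Gamma (a + (k:ℝ)/2) / Gamma ((k:ℝ)/2 + 1) * x ^ k) := by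
  have hx2 : |x ^ 2| < 1 := by rw [abs_of_nonneg (by positivity)]; nlinarith
  have h1 := fd_summ a 1 (x^2) ha one_pos hx2
  have h2 := (fd_summ (a + 1/2) (3/2) (x^2) (by positivity) (by norm_num) hx2).mul_left x
  refine (HasSum.even_add_odd (fd_congr h1.hasSum (fun m => ?_) rfl)
    (fd_congr h2.hasSum (fun m => ?_) rfl)).summable
  · have e1 : (((2*m:ℕ):ℝ))/2 = m := by push_cast; ring
    rw [e1, pow_mul, add_comm (m:ℝ)]
  · have e1 : a + (((2*m+1:ℕ):ℝ))/2 = a + 1/2 + m := by push_cast; ring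
    have e2 : (((2*m+1:ℕ):ℝ))/2 + 1 = 3/2 + m := by push_cast; ring
    rw [e1, e2, pow_succ, pow_mul]
    ring

/-- The Fisher density of the sample correlation coefficient integrates to one. -/
theorem fisherDensity_integral_eq_one (n : ℕ) (hn : 3 ≤ n) (ρ : ℝ)
    (hρ : ρ ∈ Set.Ioo (-1 : ℝ) 1) :
    ∫ r in (-1 : ℝ)..1, fisherDensity n ρ r = 1 := by
  have hn' : (3:ℝ) ≤ n := by exact_mod_cast hn
  have hρ1 : |ρ| < 1 := abs_lt.2 hρ
  have hb : 0 < ((n:ℝ)-2)/2 := by linarith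
  have ha : 0 < ((n:ℝ)-1)/2 := by linarith
  have hρ2 : |ρ ^ 2| < 1 := by
    rw [abs_of_nonneg (by positivity), ← sq_abs]; nlinarith [abs_nonneg ρ]
  have hρ3 : 0 < 1 - ρ ^ 2 := by linarith [le_abs_self (ρ ^ 2)]
  let w : ℕ → ℝ → ℝ := fun k x =>
    if |x| < 1 then x ^ k * (1 - x ^ 2) ^ (((n:ℝ)-2)/2 - 1) else 0
  let c : ℕ → ℝ := fun k =>
    (Gamma (((n : ℝ) - 1 + (k : ℝ)) / 2)) ^ 2 * (2 * ρ) ^ k / (Nat.factorial k : ℝ)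
  let C : ℝ := 2 ^ ((n : ℝ) - 3) * (1 - ρ ^ 2) ^ (((n : ℝ) - 1) / 2) / (π * Gamma ((n : ℝ) - 2))
  have hfd : ∀ r, fisherDensity n ρ r = C * ∑' k, c k * w k r := by
    intro r
    unfold fisherDensity
    by_cases h : |r| < 1
    · rw [if_pos h]
      have e : ((n:ℝ)-4)/2 = ((n:ℝ)-2)/2 - 1 := by ring
      have : ∀ k, c k * w k r = (1 - r ^ 2) ^ (((n:ℝ)-2)/2 - 1) *
          ((Gamma (((n : ℝ) - 1 + (k : ℝ)) / 2)) ^ 2 * (2 * r * ρ) ^ k / (Nat.factorial k : ℝ)) := by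
        intro k
        simp only [c, w, if_pos h, mul_pow]
        ring
      simp only [this]
      rw [tsum_mul_left, e]
      simp only [C]
      ring
    · rw [if_neg h]
      simp [w, h]
  rw [intervalIntegral.integral_of_le (by norm_num),
    setIntegral_eq_integral_of_forall_compl_eq_zero]
  swap
  · intro x hx
    unfold fisherDensity
    rw [if_neg]
    intro h
    exact hx ⟨(abs_lt.1 h).1, (abs_lt.1 h).2.le⟩
  simp only [hfd]
  rw [integral_const_mul]
  have hsum : Summable fun k => ∫ x, ‖c k * w k x‖ := by
    have := (fd_summ_all _ |ρ| ha (abs_nonneg _) hρ1).mul_left (√π * Gamma (((n:ℝ)-2)/2))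
    refine this.congr fun k => ?_
    rw [← fd_term n hn]
    simp only [norm_mul, integral_const_mul, w, fd_norm]
    rw [fd_absmoment _ hb, add_div (k:ℝ) 1 2]
    congr 1
    simp only [c, norm_div, norm_mul, norm_pow, Real.norm_eq_abs, sq_abs, Nat.abs_cast, abs_two]
  have hS := hasSum_integral_of_summable_integral_norm
    (fun k => (fd_integrable _ hb k).const_mul (c k)) hsum
  have hE := (fd_binom _ (ρ^2) ha hρ2).mul_left (√π * Gamma (((n:ℝ)-2)/2))
  have hT : HasSum (fun k => ∫ x, c k * w k x)
      (√π * Gamma (((n:ℝ)-2)/2) * (Gamma (((n:ℝ)-1)/2) * (1 - ρ^2) ^ (-(((n:ℝ)-1)/2))) + 0) := by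
    refine HasSum.even_add_odd (fd_congr hE (fun m => ?_) rfl)
      (fd_congr hasSum_zero (fun m => ?_) rfl)
    · simp only [integral_const_mul, w]
      rw [fd_even _ hb]
      have e1 : (((2*m:ℕ):ℝ))/2 = m := by push_cast; ring
      have := fd_term n hn ρ (2*m)
      simp only [c]
      rw [this, e1, Gamma_nat_eq_factorial, pow_mul]
    · simp only [integral_const_mul, w]
      rw [fd_odd, mul_zero]
  have hI : ∫ x, ∑' k, c k * w k x = _ := hS.unique hT
  rw [hI]
  have hd := Gamma_mul_Gamma_add_half (((n:ℝ)-2)/2)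
  have e1 : ((n:ℝ)-2)/2 + 1/2 = ((n:ℝ)-1)/2 := by ring
  have e2 : 2 * (((n:ℝ)-2)/2) = (n:ℝ)-2 := by ring
  have e3 : 1 - ((n:ℝ)-2) = -((n:ℝ)-3) := by ring
  rw [e1, e2, e3, rpow_neg two_pos.le] at hd
  have hg : 0 < Gamma ((n:ℝ)-2) := Gamma_pos_of_pos (by linarith)
  have hp : (0:ℝ) < 2 ^ ((n:ℝ)-3) := by positivity
  have hq : 0 < (1 - ρ^2) ^ (((n:ℝ)-1)/2) := by positivity
  have hpi := mul_self_sqrt pi_pos.le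
  rw [rpow_neg hρ3.le, add_zero]
  calc C * (√π * Gamma (((n:ℝ)-2)/2) * (Gamma (((n:ℝ)-1)/2) * ((1 - ρ^2) ^ (((n:ℝ)-1)/2))⁻¹))
      = C * √π * (Gamma (((n:ℝ)-2)/2) * Gamma (((n:ℝ)-1)/2)) * ((1 - ρ^2) ^ (((n:ℝ)-1)/2))⁻¹ := by
        ring
    _ = (C * Gamma ((n:ℝ)-2) * (2 ^ ((n:ℝ)-3))⁻¹ * ((1 - ρ^2) ^ (((n:ℝ)-1)/2))⁻¹) * (√π * √π) := by
        rw [hd]; ring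
    _ = 1 := by
        rw [hpi]
        simp only [C]
        have := pi_pos
        field_simp
end

section
/- Let n ≥ 3 be an integer, ρ ∈ (-1,1), and let R be a real random variable with law f_{n,ρ}. Then for every integer m ≥ 0, E[R^m] = (2^{n-3} (1-ρ²)^{(n-1)/2} / (π Γ(n-2))) · Σ_{k=0}^∞ (Γ((n-1+k)/2))² ((2ρ)^k / k!) · g_m(k). -/
open MeasureTheory Real

/-- `g_m(k)` from the moment formula for the sample correlation coefficient. -/
noncomputable def gMoment (n m k : ℕ) : ℝ :=
  if (m + k) % 2 = 0 then
    Gamma (((m : ℝ) + (k : ℝ) + 1) / 2) * Gamma (((n : ℝ) - 2) / 2) /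
      Gamma (((n : ℝ) + (m : ℝ) + (k : ℝ) - 1) / 2)
  else 0

/-- unnormalised beta density -/
noncomputable def auxB (α β x : ℝ) : ℝ :=
  if 0 < x ∧ x < 1 then x ^ (α - 1) * (1 - x) ^ (β - 1) else 0

lemma auxB_eq (α β : ℝ) (hα : 0 < α) (hβ : 0 < β) (x : ℝ) :
    auxB α β x = ProbabilityTheory.beta α β * ProbabilityTheory.betaPDFReal α β x := by
  have := (ProbabilityTheory.beta_pos hα hβ).ne'
  unfold auxB ProbabilityTheory.betaPDFReal
  split_ifs
  · field_simp
  · simp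

lemma auxB_nonneg (α β x : ℝ) : 0 ≤ auxB α β x := by
  unfold auxB
  split_ifs with h
  · have h1 := h.1
    have h2 : 0 < 1 - x := by linarith [h.2]
    positivity
  · exact le_rfl

lemma integral_auxB (α β : ℝ) (hα : 0 < α) (hβ : 0 < β) :
    ∫ x, auxB α β x = Gamma α * Gamma β / Gamma (α + β) := by
  simp_rw [auxB_eq α β hα hβ]
  rw [integral_const_mul, integral_eq_lintegral_of_nonneg_ae]
  · have := ProbabilityTheory.lintegral_betaPDF_eq_one hα hβ
    unfold ProbabilityTheory.betaPDF at this
    rw [this]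
    simp [ProbabilityTheory.beta]
  · refine Filter.Eventually.of_forall fun x => ?_
    have h := auxB_nonneg α β x
    rw [auxB_eq α β hα hβ] at h
    exact nonneg_of_mul_nonneg_right h (ProbabilityTheory.beta_pos hα hβ)
  · exact (ProbabilityTheory.measurable_betaPDFReal α β).aestronglyMeasurable

lemma integrable_auxB (α β : ℝ) (hα : 0 < α) (hβ : 0 < β) : Integrable (auxB α β) := by
  apply Integrable.of_integral_ne_zero
  rw [integral_auxB α β hα hβ]
  exact (ProbabilityTheory.beta_pos hα hβ).ne'

/-- weight -/
noncomputable def auxW (c r : ℝ) : ℝ := if |r| < 1 then (1 - r ^ 2) ^ (c - 1) else 0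

lemma one_sub_sq_pos {r : ℝ} (h : |r| < 1) : 0 < 1 - r ^ 2 := by
  have := (sq_lt_one_iff_abs_lt_one r).2 h
  linarith

lemma auxW_nonneg (c r : ℝ) : 0 ≤ auxW c r := by
  unfold auxW
  split_ifs with h
  · exact rpow_nonneg (one_sub_sq_pos h).le _
  · exact le_rfl

lemma measurable_auxW (c : ℝ) : Measurable (auxW c) :=
  Measurable.ite (measurableSet_lt (by fun_prop) (by fun_prop)) (by fun_prop) (by fun_prop)

lemma auxW_abs (c r : ℝ) : auxW c |r| = auxW c r := by simp [auxW]

lemma integral_auxW_even (c : ℝ) (hc : 0 < c) (j : ℕ) (hj : Even j) :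
    ∫ r, r ^ j * auxW c r = Gamma (((j : ℝ) + 1) / 2) * Gamma c / Gamma (((j : ℝ) + 1) / 2 + c) := by
  have h1 : ∫ r, r ^ j * auxW c r = ∫ r, (fun x => x ^ j * auxW c x) |r| := by
    congr 1; ext r
    simp only [hj.pow_abs, auxW_abs]
  rw [h1, integral_comp_abs (f := fun x => x ^ j * auxW c x), ← integral_auxB _ c (by positivity) hc, ← integral_const_mul]
  have h2 : ∫ x, auxB (((j : ℝ) + 1) / 2) c x = ∫ x in Set.Ioi 0, auxB (((j : ℝ) + 1) / 2) c x := by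
    rw [← integral_indicator measurableSet_Ioi]
    congr 1; ext x
    by_cases hx : 0 < x
    · rw [Set.indicator_of_mem (show x ∈ Set.Ioi 0 from hx)]
    · rw [Set.indicator_of_notMem (show x ∉ Set.Ioi 0 from hx)]
      simp [auxB, hx]
  rw [h2, ← integral_comp_rpow_Ioi_of_pos (g := auxB (((j : ℝ) + 1) / 2) c) (p := 2) two_pos]
  refine setIntegral_congr_fun measurableSet_Ioi fun x hx => ?_
  have hx : 0 < x := hx
  have hx2 : 0 < x ^ 2 := by positivity
  simp only [auxW, auxB, smul_eq_mul, rpow_two, abs_of_pos hx, hx2, true_and,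
    sq_lt_one_iff₀ hx.le]
  split_ifs
  · have : (x ^ 2) ^ (((j : ℝ) + 1) / 2 - 1) * x = x ^ j := by
      rw [← rpow_two, ← rpow_mul hx.le, ← rpow_add_one hx.ne', ← rpow_natCast]
      congr 1; ring
    rw [← this]
    norm_num
    ring
  · simp

lemma integrable_auxW (c : ℝ) (hc : 0 < c) : Integrable (auxW c) := by
  apply Integrable.of_integral_ne_zero
  have := integral_auxW_even c hc 0 (by simp)
  simp only [pow_zero, one_mul] at this
  rw [this]
  exact (ProbabilityTheory.beta_pos (by positivity) hc).ne'

lemma integral_auxW_odd (c : ℝ) (j : ℕ) (hj : Odd j) : ∫ r, r ^ j * auxW c r = 0 := by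
  have h := integral_neg_eq_self (fun r : ℝ => r ^ j * auxW c r) volume
  have h2 : ∀ r : ℝ, (-r) ^ j * auxW c (-r) = -(r ^ j * auxW c r) := fun r => by
    rw [hj.neg_pow, ← auxW_abs c (-r), abs_neg, auxW_abs]; ring
  simp only [h2, integral_neg] at h
  linarith

lemma Gamma_sq_eq (N k : ℕ) :
    Gamma (((N : ℝ) + 1 + k) / 2) ^ 2 =
      (N + k).factorial * ∫ x, auxB (((N : ℝ) + 1 + k) / 2) (((N : ℝ) + 1 + k) / 2) x := by
  have hp : (0:ℝ) < ((N : ℝ) + 1 + k) / 2 := by positivity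
  rw [integral_auxB _ _ hp hp, add_halves,
    show (N : ℝ) + 1 + k = ((N + k : ℕ) : ℝ) + 1 by push_cast; ring, Gamma_nat_eq_factorial]
  have : ((N + k).factorial : ℝ) ≠ 0 := by positivity
  field_simp

lemma auxB_split (N k : ℕ) (x : ℝ) :
    auxB (((N : ℝ) + 1 + k) / 2) (((N : ℝ) + 1 + k) / 2) x =
      auxB (((N : ℝ) + 1) / 2) (((N : ℝ) + 1) / 2) x * √(x * (1 - x)) ^ k := by
  unfold auxB
  split_ifs with h
  · have h1 := h.1
    have h2 : 0 < 1 - x := by linarith [h.2]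
    rw [← mul_rpow h1.le h2.le, ← mul_rpow h1.le h2.le, sqrt_eq_rpow, ← rpow_natCast,
      ← rpow_mul (by positivity), ← rpow_add (by positivity)]
    congr 1; ring
  · simp

lemma sqrt_le_half (x : ℝ) : √(x * (1 - x)) ≤ 1 / 2 := by
  rw [sqrt_le_left (by norm_num)]
  nlinarith [sq_nonneg (x - 1 / 2)]

lemma Gamma_sq_le (N k : ℕ) :
    Gamma (((N : ℝ) + 1 + k) / 2) ^ 2 ≤
      (N + k).factorial * ((∫ x, auxB (((N : ℝ) + 1) / 2) (((N : ℝ) + 1) / 2) x) * (1 / 2) ^ k) := by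
  rw [Gamma_sq_eq, ← integral_mul_const]
  have hp : (0:ℝ) < ((N : ℝ) + 1) / 2 := by positivity
  have hq : (0:ℝ) < ((N : ℝ) + 1 + k) / 2 := by positivity
  refine mul_le_mul_of_nonneg_left ?_ (by positivity)
  apply integral_mono (integrable_auxB _ _ hq hq) ((integrable_auxB _ _ hp hp).mul_const _)
  intro x
  simp only [auxB_split]
  have := auxB_nonneg (((N : ℝ) + 1) / 2) (((N : ℝ) + 1) / 2) x
  gcongr
  exact sqrt_le_half x

lemma fact_eq (N k : ℕ) :
    ((N + k).factorial : ℝ) = (k + N).choose N * N.factorial * k.factorial := by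
  rw [add_comm N k]
  have := Nat.add_choose_mul_factorial_mul_factorial k N
  rw [← this]; push_cast; ring

lemma summable_series (N : ℕ) (x : ℝ) (hx : |x| < 1) :
    Summable fun k : ℕ => Gamma (((N : ℝ) + 1 + k) / 2) ^ 2 * |2 * x| ^ k / (k.factorial : ℝ) := by
  have h := (summable_choose_mul_geometric_of_norm_lt_one N (r := |x|) (by simpa using hx)).mul_left
    ((N.factorial : ℝ) * ∫ x, auxB (((N : ℝ) + 1) / 2) (((N : ℝ) + 1) / 2) x)
  refine Summable.of_nonneg_of_le (fun k => by positivity) (fun k => ?_) h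
  rw [div_le_iff₀ (by positivity)]
  refine (mul_le_mul_of_nonneg_right (Gamma_sq_le N k) (by positivity)).trans (le_of_eq ?_)
  rw [fact_eq, abs_mul, mul_pow, abs_two]
  have : ((1:ℝ) / 2) ^ k * 2 ^ k = 1 := by rw [← mul_pow]; norm_num
  linear_combination ((k + N).choose N * N.factorial * k.factorial *
    (∫ x, auxB (((N : ℝ) + 1) / 2) (((N : ℝ) + 1) / 2) x) * |x| ^ k : ℝ) * this

lemma series_nonneg (N : ℕ) (x : ℝ) (hx : |x| < 1) :
    0 ≤ ∑' k : ℕ, Gamma (((N : ℝ) + 1 + k) / 2) ^ 2 * (2 * x) ^ k / (k.factorial : ℝ) := by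
  set F : ℕ → ℝ → ℝ := fun k t => ((N + k).factorial * (2 * x) ^ k / k.factorial) *
    auxB (((N : ℝ) + 1 + k) / 2) (((N : ℝ) + 1 + k) / 2) t with hF
  have hq : ∀ k : ℕ, (0:ℝ) < ((N : ℝ) + 1 + k) / 2 := fun k => by positivity
  have hint : ∀ k, Integrable (F k) := fun k => (integrable_auxB _ _ (hq k) (hq k)).const_mul _
  have hs : Summable fun k => ∫ t, ‖F k t‖ := by
    convert summable_series N x hx using 2 with k
    simp only [hF, norm_mul, norm_div, norm_pow, norm_eq_abs, abs_of_nonneg (auxB_nonneg _ _ _),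
      Nat.abs_cast]
    rw [integral_const_mul, Gamma_sq_eq, abs_mul]; ring
  have h := hasSum_integral_of_summable_integral_norm hint hs
  have h2 : ∀ k : ℕ, ∫ t, F k t =
      Gamma (((N : ℝ) + 1 + k) / 2) ^ 2 * (2 * x) ^ k / (k.factorial : ℝ) := fun k => by
    simp only [hF]
    rw [integral_const_mul, Gamma_sq_eq]; ring
  simp only [h2] at h
  rw [h.tsum_eq]
  refine integral_nonneg fun t => ?_
  have hz : ‖2 * x * √(t * (1 - t))‖ < 1 := by
    rw [norm_mul, norm_mul, norm_eq_abs, norm_eq_abs, norm_eq_abs, abs_two,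
      abs_of_nonneg (sqrt_nonneg _)]
    have := sqrt_le_half t
    nlinarith [sqrt_nonneg (t * (1 - t)), abs_nonneg x]
  have h3 := (hasSum_choose_mul_geometric_of_norm_lt_one N hz).mul_left
    ((N.factorial : ℝ) * auxB (((N : ℝ) + 1) / 2) (((N : ℝ) + 1) / 2) t)
  have h4 : HasSum (fun k => F k t) ((N.factorial : ℝ) *
      auxB (((N : ℝ) + 1) / 2) (((N : ℝ) + 1) / 2) t *
        (1 / (1 - 2 * x * √(t * (1 - t))) ^ (N + 1))) := by
    refine (congrArg (fun f => HasSum f _) (funext fun k => ?_)).mpr h3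
    simp only [hF]
    rw [auxB_split, fact_eq]
    have : (k.factorial : ℝ) ≠ 0 := by positivity
    field_simp
    rw [mul_pow (2 * x)]
    ring
  change 0 ≤ ∑' k, F k t
  rw [h4.tsum_eq]
  have := auxB_nonneg (((N : ℝ) + 1) / 2) (((N : ℝ) + 1) / 2) t
  have h5 : 0 < 1 - 2 * x * √(t * (1 - t)) := by
    have := (abs_lt.1 hz).2
    linarith
  positivity

/-- The `m`-th moment of the sample correlation coefficient. -/
theorem moment_formula {Ω : Type*} [MeasurableSpace Ω] (P : Measure Ω) [IsProbabilityMeasure P]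
    (n : ℕ) (hn : 3 ≤ n) (ρ : ℝ) (hρ : ρ ∈ Set.Ioo (-1 : ℝ) 1)
    (R : Ω → ℝ) (hR : Measurable R)
    (hlaw : Measure.map R P = volume.withDensity fun r => ENNReal.ofReal (fisherDensity n ρ r))
    (m : ℕ) :
    ∫ ω, (R ω) ^ m ∂P =
      (2 ^ ((n : ℝ) - 3) * (1 - ρ ^ 2) ^ (((n : ℝ) - 1) / 2) / (π * Gamma ((n : ℝ) - 2))) *
        ∑' k : ℕ, (Gamma (((n : ℝ) - 1 + (k : ℝ)) / 2)) ^ 2 *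
          ((2 * ρ) ^ k / (Nat.factorial k : ℝ)) * gMoment n m k := by
  obtain ⟨N, rfl⟩ : ∃ N, n = N + 2 := ⟨n - 2, by omega⟩
  have hN : (0:ℝ) < N := by
    have : 0 < N := by omega
    exact_mod_cast this
  have hρ1 : |ρ| < 1 := abs_lt.2 hρ
  have hn1 : ((N + 2 : ℕ) : ℝ) - 1 = N + 1 := by push_cast; ring
  have hn2 : ((N + 2 : ℕ) : ℝ) - 2 = N := by push_cast; ring
  have hn4 : (((N + 2 : ℕ) : ℝ) - 4) / 2 = (N : ℝ) / 2 - 1 := by push_cast; ring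
  have hc : (0:ℝ) < N / 2 := by positivity
  set C : ℝ := 2 ^ (((N + 2 : ℕ) : ℝ) - 3) * (1 - ρ ^ 2) ^ ((((N + 2 : ℕ) : ℝ) - 1) / 2) /
    (π * Gamma (((N + 2 : ℕ) : ℝ) - 2)) with hC
  have hC0 : 0 ≤ C := by
    have h1 := (one_sub_sq_pos hρ1)
    have h2 : 0 < Gamma (((N + 2 : ℕ) : ℝ) - 2) := by rw [hn2]; exact Gamma_pos_of_pos hN
    positivity
  -- density in convenient form
  have hdens : ∀ r, fisherDensity (N + 2) ρ r = C * (auxW (N / 2) r *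
      ∑' k : ℕ, Gamma (((N : ℝ) + 1 + k) / 2) ^ 2 * (2 * (r * ρ)) ^ k / (k.factorial : ℝ)) := by
    intro r
    unfold fisherDensity auxW
    split_ifs
    · rw [hn4, hC, hn1]
      simp only [mul_assoc]
      ring
    · simp
  have hprod : ∀ r : ℝ, |r| < 1 → |r * ρ| < 1 := fun r hr => by
    rw [abs_mul]; nlinarith [abs_nonneg r, abs_nonneg ρ]
  have hnn : ∀ r, 0 ≤ fisherDensity (N + 2) ρ r := by
    intro r
    by_cases hr : |r| < 1
    · rw [hdens]
      exact mul_nonneg hC0 (mul_nonneg (auxW_nonneg _ _) (series_nonneg N _ (hprod r hr)))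
    · simp [fisherDensity, hr]
  have hmeas : Measurable (fisherDensity (N + 2) ρ) := by
    have : fisherDensity (N + 2) ρ = fun r => C * (auxW (N / 2) r *
      ∑' k : ℕ, Gamma (((N : ℝ) + 1 + k) / 2) ^ 2 * (2 * (r * ρ)) ^ k / (k.factorial : ℝ)) :=
      funext hdens
    rw [this]
    refine measurable_const.mul ((measurable_auxW _).mul ?_)
    exact Measurable.tsum fun k => by fun_prop
  have hE : ∫ ω, (R ω) ^ m ∂P = ∫ r, fisherDensity (N + 2) ρ r * r ^ m := by
    rw [← integral_map (f := fun r : ℝ => r ^ m) hR.aemeasurable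
      (by fun_prop), hlaw,
      integral_withDensity_eq_integral_toReal_smul hmeas.ennreal_ofReal (by simp)]
    simp only [ENNReal.toReal_ofReal (hnn _), smul_eq_mul]
  set G : ℕ → ℝ → ℝ := fun k r => (Gamma (((N : ℝ) + 1 + k) / 2) ^ 2 *
    ((2 * ρ) ^ k / (k.factorial : ℝ))) * (r ^ (m + k) * auxW (N / 2) r) with hG
  have hpw : ∀ j : ℕ, ∀ r : ℝ, ‖r ^ j * auxW (N / 2) r‖ ≤ auxW (N / 2) r := by
    intro j r
    rw [norm_mul, norm_pow, norm_eq_abs, norm_eq_abs, abs_of_nonneg (auxW_nonneg _ _)]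
    by_cases hr : |r| < 1
    · exact mul_le_of_le_one_left (auxW_nonneg _ _) (pow_le_one₀ (abs_nonneg _) hr.le)
    · simp [auxW, hr]
  have hWint : ∀ j : ℕ, Integrable fun r : ℝ => r ^ j * auxW (N / 2) r := fun j =>
    (integrable_auxW _ hc).mono'
      ((by fun_prop : Measurable fun r : ℝ => r ^ j).mul (measurable_auxW _)).aestronglyMeasurable
      (Filter.Eventually.of_forall (hpw j))
  have hGint : ∀ k, Integrable (G k) := fun k => (hWint _).const_mul _
  have hGs : Summable fun k => ∫ r, ‖G k r‖ := by
    refine Summable.of_nonneg_of_le (fun k => integral_nonneg fun r => norm_nonneg _) (fun k => ?_)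
      ((summable_series N ρ hρ1).mul_right (∫ r, auxW (N / 2) r))
    rw [← integral_const_mul]
    refine integral_mono (hGint k).norm ((integrable_auxW _ hc).const_mul _) fun r => ?_
    simp only [hG]
    rw [norm_mul]
    have : ‖Gamma (((N : ℝ) + 1 + k) / 2) ^ 2 * ((2 * ρ) ^ k / (k.factorial : ℝ))‖ =
        Gamma (((N : ℝ) + 1 + k) / 2) ^ 2 * |2 * ρ| ^ k / (k.factorial : ℝ) := by
      rw [norm_mul, norm_div, norm_pow, norm_pow, norm_eq_abs, norm_eq_abs, norm_eq_abs, sq_abs,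
        Nat.abs_cast, mul_div_assoc]
    rw [this]
    exact mul_le_mul_of_nonneg_left (hpw _ r) (by positivity)
  have hsum := hasSum_integral_of_summable_integral_norm hGint hGs
  have hval : ∀ k : ℕ, ∫ r, G k r = (Gamma ((((N + 2 : ℕ) : ℝ) - 1 + (k : ℝ)) / 2)) ^ 2 *
          ((2 * ρ) ^ k / (Nat.factorial k : ℝ)) * gMoment (N + 2) m k := by
    intro k
    simp only [hG]
    rw [integral_const_mul, hn1]
    congr 1
    unfold gMoment
    split_ifs with h
    · rw [integral_auxW_even _ hc _ (Nat.even_iff.2 h), hn2]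
      push_cast
      congr 2
      ring
    · exact integral_auxW_odd _ _ (Nat.odd_iff.2 (by omega))
  simp only [hval] at hsum
  rw [hsum.tsum_eq, hE, ← integral_const_mul]
  congr 1; ext r
  rw [hdens, mul_assoc, mul_assoc]
  congr 1
  rw [mul_comm (auxW _ _), ← tsum_mul_right, ← tsum_mul_right]
  congr 1; ext k
  simp only [hG]
  rw [pow_add, show 2 * (r * ρ) = r * (2 * ρ) by ring, mul_pow r]
  ring
end

section
/- The function κ is nondecreasing on (1/2, ∞): for all real z, w with 1/2 < z ≤ w, κ(z) ≤ κ(w). -/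
open Real

/-- `κ(z) = Γ(z)² / (Γ(z+1/2) Γ(z-1/2))`. -/
noncomputable def kappa (z : ℝ) : ℝ :=
  Gamma z ^ 2 / (Gamma (z + 1 / 2) * Gamma (z - 1 / 2))

theorem kappa_tendsto (z : ℝ) (hz : 1 / 2 < z) :
    Filter.Tendsto (fun n : ℕ => ∏ j ∈ Finset.range (n + 1), (1 - 1 / (4 * (z + j) ^ 2)))
      Filter.atTop (nhds (kappa z)) := by
  have h := ((GammaSeq_tendsto_Gamma z).pow 2).div
    ((GammaSeq_tendsto_Gamma (z + 1 / 2)).mul (GammaSeq_tendsto_Gamma (z - 1 / 2)))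
    (mul_pos (Gamma_pos_of_pos (by linarith)) (Gamma_pos_of_pos (by linarith))).ne'
  refine Filter.Tendsto.congr' ?_ h
  filter_upwards [Filter.eventually_gt_atTop 0] with n hn
  have hn' : (0 : ℝ) < n := by exact_mod_cast hn
  have hp : ∀ s : ℝ, 0 < s → 0 < ∏ j ∈ Finset.range (n + 1), (s + j) := fun s hs =>
    Finset.prod_pos fun j _ => by positivity
  have e : ∏ j ∈ Finset.range (n + 1), (1 - 1 / (4 * (z + j) ^ 2))
      = (∏ j ∈ Finset.range (n + 1), (z + 1 / 2 + j)) * (∏ j ∈ Finset.range (n + 1), (z - 1 / 2 + j))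
        / (∏ j ∈ Finset.range (n + 1), (z + j)) ^ 2 := by
    rw [← Finset.prod_mul_distrib, ← Finset.prod_pow, ← Finset.prod_div_distrib]
    refine Finset.prod_congr rfl fun j _ => ?_
    have : 0 < z + j := by have : (0 : ℝ) ≤ j := by positivity
                           linarith
    field_simp
    ring
  have h1 := hp z (by linarith)
  have h2 := hp (z + 1 / 2) (by linarith)
  have h3 := hp (z - 1 / 2) (by linarith)
  have hpow : (n : ℝ) ^ (z + 1 / 2) * (n : ℝ) ^ (z - 1 / 2) = ((n : ℝ) ^ z) ^ 2 := by
    rw [← rpow_add hn', sq, ← rpow_add hn']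
    congr 1
    ring
  have hf : (0 : ℝ) < (n.factorial : ℝ) := by positivity
  have hq : 0 < (n : ℝ) ^ z := by positivity
  rw [e]
  simp only [GammaSeq, Pi.div_apply]
  rw [div_mul_div_comm, mul_mul_mul_comm, hpow]
  generalize (∏ j ∈ Finset.range (n + 1), (z + j)) = A at *
  generalize (∏ j ∈ Finset.range (n + 1), (z + 1 / 2 + j)) = B at *
  generalize (∏ j ∈ Finset.range (n + 1), (z - 1 / 2 + j)) = C at *
  field_simp

/-- `κ` is nondecreasing on `(1/2, ∞)`. -/
theorem kappa_monotoneOn (z w : ℝ) (hz : 1 / 2 < z) (hzw : z ≤ w) :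
    kappa z ≤ kappa w := by
  refine le_of_tendsto_of_tendsto' (kappa_tendsto z hz) (kappa_tendsto w (by linarith)) fun n => ?_
  refine Finset.prod_le_prod (fun j _ => ?_) (fun j _ => ?_)
  · have h0 : (0 : ℝ) ≤ j := by positivity
    rw [sub_nonneg, div_le_one (by positivity)]
    nlinarith
  · have h0 : (0 : ℝ) ≤ j := by positivity
    have h1 : 0 < z + j := by linarith
    gcongr
end

section
/- For every real z > 1/2, κ(z) ≥ 1 - 1/(2z); in particular, for every integer n ≥ 2, Γ(n/2)² / (Γ((n+1)/2) Γ((n-1)/2)) ≥ 1 - 1/n. -/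
open Real

theorem kappa_aux (z : ℝ) (hz : 1 / 2 < z) : 1 - 1 / (2 * z) ≤ kappa z := by
  have hz0 : 0 < z := by linarith
  have h := Real.Gamma_mul_add_mul_le_rpow_Gamma_mul_rpow_Gamma (s := z) (t := z + 1)
    (a := 1 / 2) (b := 1 / 2) hz0 (by linarith) (by norm_num) (by norm_num) (by norm_num)
  have e : 1 / 2 * z + 1 / 2 * (z + 1) = z + 1 / 2 := by ring
  rw [e, ← Real.sqrt_eq_rpow, ← Real.sqrt_eq_rpow, Real.Gamma_add_one hz0.ne'] at h
  have hg : 0 < Gamma z := Real.Gamma_pos_of_pos hz0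
  have hG : 0 < Gamma (z + 1 / 2) := Real.Gamma_pos_of_pos (by linarith)
  have hH : 0 < Gamma (z - 1 / 2) := Real.Gamma_pos_of_pos (by linarith)
  have hrec : Gamma (z + 1 / 2) = (z - 1 / 2) * Gamma (z - 1 / 2) := by
    rw [← Real.Gamma_add_one (by linarith)]
    congr 1
    ring
  have h2 : Gamma (z + 1 / 2) ^ 2 ≤ z * Gamma z ^ 2 := by
    have h3 := pow_le_pow_left₀ hG.le h 2
    rw [mul_pow, Real.sq_sqrt hg.le, Real.sq_sqrt (by positivity)] at h3
    linarith
  unfold kappa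
  rw [le_div_iff₀ (by positivity)]
  have e2 : (1 - 1 / (2 * z)) * (Gamma (z + 1 / 2) * Gamma (z - 1 / 2))
      = Gamma (z + 1 / 2) * ((z - 1 / 2) * Gamma (z - 1 / 2)) / z := by
    field_simp
  rw [e2, ← hrec, div_le_iff₀ hz0]
  linarith

/-- For `z > 1/2`, `κ(z) ≥ 1 - 1/(2z)`; in particular, for every integer `n ≥ 2`,
`Γ(n/2)² / (Γ((n+1)/2) Γ((n-1)/2)) ≥ 1 - 1/n`. -/
theorem kappa_lower_bound :
    (∀ z : ℝ, 1 / 2 < z → 1 - 1 / (2 * z) ≤ kappa z) ∧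
      ∀ n : ℕ, 2 ≤ n →
        1 - 1 / (n : ℝ) ≤
          Gamma ((n : ℝ) / 2) ^ 2 /
            (Gamma (((n : ℝ) + 1) / 2) * Gamma (((n : ℝ) - 1) / 2)) := by
  refine ⟨kappa_aux, fun n hn => ?_⟩
  have hn' : (2 : ℝ) ≤ n := by exact_mod_cast hn
  have h := kappa_aux ((n : ℝ) / 2) (by linarith)
  unfold kappa at h
  rw [show 2 * ((n : ℝ) / 2) = n by ring, show (n : ℝ) / 2 + 1 / 2 = (n + 1) / 2 by ring,
    show (n : ℝ) / 2 - 1 / 2 = (n - 1) / 2 by ring] at h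
  exact h
end

section
/- Let n ≥ 3 be an integer, ρ ∈ (-1,1), and let R be a real random variable with law f_{n,ρ}. If 0 ≤ ρ, then (1 - 1/n) ρ ≤ E[R] ≤ ρ; if ρ ≤ 0, then ρ ≤ E[R] ≤ (1 - 1/n) ρ. In particular E[R] has the same sign as ρ and (1 - 1/n)|ρ| ≤ |E[R]| ≤ |ρ|. -/
open MeasureTheory Real

/-- Log-convexity of Gamma at the midpoint. -/
lemma fd_gamma_mid (x : ℝ) (hx : 0 < x) :
    Gamma (x + 1 / 2) ^ 2 ≤ Gamma x * Gamma (x + 1) := by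
  have h := Real.Gamma_mul_add_mul_le_rpow_Gamma_mul_rpow_Gamma (s := x) (t := x + 1)
    (a := 1 / 2) (b := 1 / 2) hx (by linarith) (by norm_num) (by norm_num) (by norm_num)
  have e : (1 / 2 : ℝ) * x + 1 / 2 * (x + 1) = x + 1 / 2 := by ring
  rw [e] at h
  have h0 := Gamma_pos_of_pos hx
  have h1 := Gamma_pos_of_pos (show 0 < x + 1 by linarith)
  have h2 := Gamma_pos_of_pos (show 0 < x + 1 / 2 by linarith)
  rw [← Real.mul_rpow h0.le h1.le, ← Real.sqrt_eq_rpow] at h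
  calc Gamma (x + 1 / 2) ^ 2 ≤ (√(Gamma x * Gamma (x + 1))) ^ 2 := by gcongr
    _ = _ := Real.sq_sqrt (by positivity)

lemma fd_gamma_upper (x : ℝ) (hx : 0 < x) :
    Gamma (x + 1 / 2) ^ 2 ≤ x * Gamma x ^ 2 := by
  have h := fd_gamma_mid x hx
  rw [Real.Gamma_add_one hx.ne'] at h
  linarith

lemma fd_gamma_lower (x : ℝ) (hx : 0 < x) :
    x ^ 2 * Gamma x ^ 2 ≤ (x + 1 / 2) * Gamma (x + 1 / 2) ^ 2 := by
  have h := fd_gamma_upper (x + 1 / 2) (by linarith)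
  have e : x + 1 / 2 + 1 / 2 = x + 1 := by ring
  rw [e, Real.Gamma_add_one hx.ne'] at h
  linarith

/-- Coefficients of the series in Fisher's density. -/
noncomputable def fdCoef (m y : ℝ) (k : ℕ) : ℝ :=
  (Gamma ((m + k) / 2)) ^ 2 * y ^ k / (Nat.factorial k : ℝ)

lemma fdCoef_succ_le (m : ℝ) (hm : 2 ≤ m) (y : ℝ) (k : ℕ) :
    ‖fdCoef m y (k + 1)‖ ≤ ((m + k) / (k + 1) * (|y| / 2)) * ‖fdCoef m y k‖ := by
  have hx : 0 < (m + k) / 2 := by positivity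
  have h := fd_gamma_upper _ hx
  have e : (m + k) / 2 + 1 / 2 = (m + (k + 1 : ℕ)) / 2 := by push_cast; ring
  rw [e] at h
  have hk : (0 : ℝ) < Nat.factorial k := by positivity
  simp only [fdCoef, norm_div, norm_mul, norm_pow, Real.norm_eq_abs, sq_abs, Nat.abs_cast,
    Nat.factorial_succ, Nat.cast_mul, pow_succ |y| k]
  calc _ ≤ ((m + k) / 2 * Gamma ((m + k) / 2) ^ 2) * (|y| ^ k * |y|) /
        (((k + 1 : ℕ) : ℝ) * (Nat.factorial k : ℝ)) := by gcongr
    _ = _ := by push_cast; field_simp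

lemma fdCoef_summable (m : ℝ) (hm : 2 ≤ m) (y : ℝ) (hy : |y| < 2) :
    Summable (fdCoef m y) := by
  obtain ⟨q, hq1, hq2⟩ := exists_between (show |y| / 2 < 1 by linarith)
  refine summable_of_ratio_norm_eventually_le hq2 ?_
  have ht : Filter.Tendsto (fun k : ℕ => (m + k) / ((k : ℝ) + 1) * (|y| / 2)) Filter.atTop
      (nhds (1 * (|y| / 2))) := by
    refine Filter.Tendsto.mul_const _ ?_
    have h1 : Filter.Tendsto (fun k : ℕ => 1 + (m - 1) * (1 / ((k : ℝ) + 1))) Filter.atTop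
        (nhds (1 + (m - 1) * 0)) :=
      (tendsto_one_div_add_atTop_nhds_zero_nat.const_mul _).const_add _
    simp only [mul_zero, add_zero] at h1
    refine h1.congr fun k => ?_
    have : (k : ℝ) + 1 ≠ 0 := by positivity
    field_simp
    ring
  rw [one_mul] at ht
  filter_upwards [ht.eventually (gt_mem_nhds hq1)] with k hk
  exact (fdCoef_succ_le m hm y k).trans (by gcongr)

/-- The series is nonnegative (also for negative argument). -/
lemma fdSeries_nonneg (m : ℝ) (hm : 2 ≤ m) (y : ℝ) (hy : |y| < 2) :
    0 ≤ ∑' k, fdCoef m y k := by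
  set ν : Measure ℝ := volume.restrict (Set.Ioi 0) with hν
  let g : ℕ → ℝ → ℝ := fun k s => rexp (-s) * s ^ ((m + k) / 2 - 1)
  let F : ℕ → ℝ × ℝ → ℝ := fun k z => g k z.1 * g k z.2 * (y ^ k / (Nat.factorial k : ℝ))
  have hpos : ∀ k : ℕ, 0 < (m + k) / 2 := fun k => by positivity
  have hgi : ∀ k, Integrable (g k) ν := fun k => Real.GammaIntegral_convergent (hpos k)
  have hg : ∀ k, ∫ s, g k s ∂ν = Gamma ((m + k) / 2) :=
    fun k => (Real.Gamma_eq_integral (hpos k)).symm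
  have hgg : ∀ k, Integrable (fun z : ℝ × ℝ => g k z.1 * g k z.2) (ν.prod ν) :=
    fun k => (hgi k).mul_prod (hgi k)
  have hFi : ∀ k, Integrable (F k) (ν.prod ν) := fun k => (hgg k).mul_const _
  have hmem : ∀ᵐ z ∂(ν.prod ν), z ∈ (Set.Ioi (0 : ℝ)) ×ˢ (Set.Ioi (0 : ℝ)) := by
    rw [hν, Measure.prod_restrict]
    exact ae_restrict_mem (measurableSet_Ioi.prod measurableSet_Ioi)
  have hF : ∀ k, ∫ z, F k z ∂(ν.prod ν) = fdCoef m y k := by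
    intro k
    simp only [F]
    rw [integral_mul_const, integral_prod_mul, hg, fdCoef]
    ring
  have hFn : ∀ k, ∫ z, ‖F k z‖ ∂(ν.prod ν) = fdCoef m |y| k := by
    intro k
    have : ∫ z, ‖F k z‖ ∂(ν.prod ν) =
        ∫ z, g k z.1 * g k z.2 * (|y| ^ k / (Nat.factorial k : ℝ)) ∂(ν.prod ν) := by
      refine integral_congr_ae ?_
      filter_upwards [hmem] with z hz
      have h1 : (0 : ℝ) < z.1 := hz.1
      have h2 : (0 : ℝ) < z.2 := hz.2
      have h3 : 0 ≤ g k z.1 * g k z.2 := by simp only [g]; positivity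
      simp only [F, norm_mul (g k z.1 * g k z.2), norm_div, norm_pow, Real.norm_eq_abs,
        Nat.abs_cast, abs_of_nonneg h3]
    rw [this, integral_mul_const, integral_prod_mul, hg, fdCoef]
    ring
  have hs := hasSum_integral_of_summable_integral_norm hFi (by
    simp only [hFn]
    exact fdCoef_summable m hm |y| (by rwa [abs_abs]))
  simp only [hF] at hs
  rw [hs.tsum_eq]
  refine integral_nonneg_of_ae ?_
  filter_upwards [hmem] with z hz
  have h1 : (0 : ℝ) < z.1 := hz.1
  have h2 : (0 : ℝ) < z.2 := hz.2
  have key : ∀ (k : ℕ) (s : ℝ), 0 < s → g k s = rexp (-s) * s ^ (m / 2 - 1) * (√s) ^ k := by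
    intro k s hs
    simp only [g]
    rw [Real.sqrt_eq_rpow, ← Real.rpow_mul_natCast hs.le, mul_assoc, ← Real.rpow_add hs]
    congr 2
    ring
  have e : ∀ k, F k z = (rexp (-z.1) * z.1 ^ (m / 2 - 1)) * (rexp (-z.2) * z.2 ^ (m / 2 - 1)) *
      ((√z.1 * √z.2 * y) ^ k / (Nat.factorial k : ℝ)) := by
    intro k
    simp only [F]
    rw [key k _ h1, key k _ h2, mul_pow, mul_pow]
    ring
  simp only [e, Pi.zero_apply]
  rw [tsum_mul_left, (NormedSpace.expSeries_div_hasSum_exp (√z.1 * √z.2 * y)).tsum_eq,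
    ← Real.exp_eq_exp_ℝ]
  positivity

/-- The weight. -/
noncomputable def fdW (m r : ℝ) : ℝ := (1 - r ^ 2) ^ ((m - 3) / 2)

lemma fdW_base {r : ℝ} (hr : r ∈ Set.Ioo (-1 : ℝ) 1) : 0 < 1 - r ^ 2 := by
  nlinarith [hr.1, hr.2]

lemma fdW_nonneg (m : ℝ) {r : ℝ} (hr : r ∈ Set.Ioo (-1 : ℝ) 1) : 0 ≤ fdW m r :=
  (Real.rpow_pos_of_pos (fdW_base hr) _).le

lemma fdW_cont (m : ℝ) : ContinuousOn (fdW m) (Set.Ioo (-1) 1) := by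
  unfold fdW
  refine ContinuousOn.rpow_const (by fun_prop) fun r hr => Or.inl (fdW_base hr).ne'

lemma fdW_int (m : ℝ) (hm : 2 ≤ m) : IntegrableOn (fdW m) (Set.Ioo (-1) 1) := by
  have h := intervalIntegral.integrableOn_deriv_of_nonneg (g := arcsin)
    (g' := fun x => 1 / √(1 - x ^ 2)) (a := -1) (b := 1) Real.continuous_arcsin.continuousOn
    (fun x hx => Real.hasDerivAt_arcsin hx.1.ne' hx.2.ne) (fun x hx => by positivity)
  have h' := h.mono_set Set.Ioo_subset_Ioc_self
  refine Integrable.mono' h' ((fdW_cont m).aestronglyMeasurable measurableSet_Ioo) ?_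
  filter_upwards [ae_restrict_mem measurableSet_Ioo] with r hr
  rw [Real.norm_of_nonneg (fdW_nonneg m hr), fdW, Real.sqrt_eq_rpow, one_div,
    ← Real.rpow_neg (fdW_base hr).le]
  exact Real.rpow_le_rpow_of_exponent_ge (fdW_base hr) (by nlinarith [sq_nonneg r]) (by linarith)

noncomputable def fdJ (m : ℝ) (k : ℕ) : ℝ := ∫ r in Set.Ioo (-1 : ℝ) 1, r ^ k * fdW m r

lemma fdW_pow_le (m : ℝ) (k : ℕ) {r : ℝ} (hr : r ∈ Set.Ioo (-1 : ℝ) 1) :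
    ‖r ^ k * fdW m r‖ ≤ fdW m r := by
  rw [norm_mul, Real.norm_of_nonneg (fdW_nonneg m hr), norm_pow, Real.norm_eq_abs]
  have : |r| ^ k ≤ 1 := pow_le_one₀ (abs_nonneg r) (abs_lt.mpr hr).le
  nlinarith [fdW_nonneg m hr]

lemma fdW_pow_int (m : ℝ) (hm : 2 ≤ m) (k : ℕ) :
    IntegrableOn (fun r => r ^ k * fdW m r) (Set.Ioo (-1) 1) := by
  refine Integrable.mono' (fdW_int m hm)
    (((continuousOn_pow k).mul (fdW_cont m)).aestronglyMeasurable measurableSet_Ioo) ?_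
  filter_upwards [ae_restrict_mem measurableSet_Ioo] with r hr
  exact fdW_pow_le m k hr

lemma fdJ_eq (m : ℝ) (k : ℕ) : fdJ m k = ∫ r in (-1 : ℝ)..1, r ^ k * fdW m r := by
  rw [fdJ, intervalIntegral.integral_of_le (by norm_num), integral_Ioc_eq_integral_Ioo]

lemma fdJ_odd (m : ℝ) (j : ℕ) : fdJ m (2 * j + 1) = 0 := by
  have h := intervalIntegral.integral_comp_neg (a := -1) (b := 1)
    (fun r : ℝ => r ^ (2 * j + 1) * fdW m r)
  have e : ∀ r : ℝ, (-r) ^ (2 * j + 1) * fdW m (-r) = -(r ^ (2 * j + 1) * fdW m r) := by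
    intro r
    rw [Odd.neg_pow ⟨j, rfl⟩]
    simp [fdW]
  simp only [e, intervalIntegral.integral_neg, neg_neg] at h
  rw [← fdJ_eq] at h
  linarith

lemma fdJ_even_nonneg (m : ℝ) (j : ℕ) : 0 ≤ fdJ m (2 * j) := by
  refine setIntegral_nonneg measurableSet_Ioo fun r hr => ?_
  have := fdW_nonneg m hr
  rw [pow_mul]
  positivity

lemma fdJ_rec (m : ℝ) (hm : 2 ≤ m) (k : ℕ) : (k + 1) * fdJ m k = (k + m) * fdJ m (k + 2) := by
  have hii : ∀ k, IntervalIntegrable (fun r => r ^ k * fdW m r) volume (-1) 1 := fun k =>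
    (intervalIntegrable_iff_integrableOn_Ioo_of_le (by norm_num)).2 (fdW_pow_int m hm k)
  have h := intervalIntegral.integral_eq_sub_of_hasDerivAt_of_le (a := -1) (b := 1)
    (f := fun r : ℝ => r ^ (k + 1) * (1 - r ^ 2) ^ ((m - 1) / 2))
    (f' := fun r => (k + 1) * (r ^ k * fdW m r) - (k + m) * (r ^ (k + 2) * fdW m r))
    (by norm_num) ?_ ?_ (((hii k).const_mul _).sub ((hii (k + 2)).const_mul _))
  · rw [intervalIntegral.integral_sub ((hii k).const_mul _) ((hii (k + 2)).const_mul _),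
      intervalIntegral.integral_const_mul, intervalIntegral.integral_const_mul,
      ← fdJ_eq, ← fdJ_eq] at h
    have h0 : (0 : ℝ) ^ ((m - 1) / 2) = 0 := Real.zero_rpow (by linarith)
    norm_num [h0] at h
    linarith
  · refine (continuousOn_pow _).mul (ContinuousOn.rpow_const (by fun_prop) fun r hr => Or.inr ?_)
    linarith
  · intro r hr
    have hb := fdW_base hr
    have d1 : HasDerivAt (fun r : ℝ => 1 - r ^ 2) (-(2 * r)) r := by
      simpa using (hasDerivAt_pow 2 r).const_sub 1
    have d2 := d1.rpow_const (p := (m - 1) / 2) (Or.inl hb.ne')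
    have d3 := (hasDerivAt_pow (k + 1) r).mul d2
    refine d3.congr_deriv ?_
    have e1 : (m - 1) / 2 - 1 = (m - 3) / 2 := by ring
    have e2 : (1 - r ^ 2) ^ ((m - 1) / 2) = (1 - r ^ 2) ^ ((m - 3) / 2) * (1 - r ^ 2) := by
      rw [← Real.rpow_add_one hb.ne']
      congr 1
      ring
    rw [e1, e2, fdW]
    push_cast
    ring

/-- Moments of the unnormalised density as a series. -/
lemma fd_moment (m : ℝ) (hm : 2 ≤ m) (y : ℝ) (hy : |y| < 2) (e : ℕ) :
    HasSum (fun k => fdCoef m y k * fdJ m (k + e))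
      (∫ r in Set.Ioo (-1 : ℝ) 1, r ^ e * (fdW m r * ∑' k, fdCoef m y k * r ^ k)) := by
  have h := hasSum_integral_of_summable_integral_norm (μ := volume.restrict (Set.Ioo (-1 : ℝ) 1))
    (F := fun (k : ℕ) (r : ℝ) => fdCoef m y k * (r ^ (k + e) * fdW m r))
    (fun k => (fdW_pow_int m hm (k + e)).const_mul _) ?_
  · simp only [integral_const_mul] at h
    have hE : ∫ r in Set.Ioo (-1 : ℝ) 1, r ^ e * (fdW m r * ∑' k, fdCoef m y k * r ^ k) =
        ∫ r in Set.Ioo (-1 : ℝ) 1, ∑' k, fdCoef m y k * (r ^ (k + e) * fdW m r) := by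
      refine integral_congr_ae (Filter.Eventually.of_forall fun r => ?_)
      beta_reduce
      rw [← tsum_mul_left, ← tsum_mul_left]
      refine tsum_congr fun k => ?_
      ring
    rw [hE]
    exact h
  · refine Summable.of_nonneg_of_le (fun k => integral_nonneg fun r => norm_nonneg _)
      (fun k => ?_) ((fdCoef_summable m hm y hy).norm.mul_right (fdJ m 0))
    simp only [norm_mul (fdCoef m y k), integral_const_mul]
    refine mul_le_mul_of_nonneg_left ?_ (norm_nonneg _)
    refine setIntegral_mono_on (fdW_pow_int m hm (k + e)).norm (fdW_pow_int m hm 0)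
      measurableSet_Ioo fun r hr => ?_
    simpa using fdW_pow_le m (k + e) hr

lemma fd_series_cont (m : ℝ) (hm : 2 ≤ m) (y : ℝ) (hy : |y| < 2) :
    ContinuousOn (fun r : ℝ => ∑' k, fdCoef m y k * r ^ k) (Set.Ioo (-1) 1) := by
  refine continuousOn_tsum (fun k => by fun_prop) (fdCoef_summable m hm y hy).norm
    fun k r hr => ?_
  rw [norm_mul, norm_pow, Real.norm_eq_abs r]
  have : |r| ^ k ≤ 1 := pow_le_one₀ (abs_nonneg r) (abs_lt.mpr hr).le
  nlinarith [norm_nonneg (fdCoef m y k)]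

lemma fdCoef_ratio (m : ℝ) (hm : 2 ≤ m) (ρ : ℝ) (j : ℕ) :
    ∃ c, m / (m + 1) ≤ c ∧ c ≤ 1 ∧
      fdCoef m (2 * ρ) (2 * j + 1) * fdJ m (2 * j + 1 + 1) =
        c * ρ * (fdCoef m (2 * ρ) (2 * j) * fdJ m (2 * j)) := by
  have hx : 0 < m / 2 + j := by positivity
  have hG := Gamma_pos_of_pos hx
  refine ⟨Gamma (m / 2 + j + 1 / 2) ^ 2 / ((m / 2 + j) * Gamma (m / 2 + j) ^ 2), ?_, ?_, ?_⟩
  · have h := fd_gamma_lower _ hx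
    rw [div_le_div_iff₀ (by linarith) (by positivity)]
    set x := m / 2 + (j : ℝ) with hxd
    have hxm : m ≤ 2 * x := by
      have : (0 : ℝ) ≤ j := by positivity
      linarith
    have h2 : m * (x + 1 / 2) ≤ x * (m + 1) := by nlinarith
    have h3 : (m * (x * Gamma x ^ 2)) * (x + 1 / 2) ≤
        (Gamma (x + 1 / 2) ^ 2 * (m + 1)) * (x + 1 / 2) := by
      calc _ = (m * (x + 1 / 2)) * (x * Gamma x ^ 2) := by ring
        _ ≤ (x * (m + 1)) * (x * Gamma x ^ 2) := by gcongr
        _ = (m + 1) * (x ^ 2 * Gamma x ^ 2) := by ring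
        _ ≤ (m + 1) * ((x + 1 / 2) * Gamma (x + 1 / 2) ^ 2) := by gcongr
        _ = _ := by ring
    exact le_of_mul_le_mul_right h3 (by linarith)
  · rw [div_le_one (by positivity)]
    exact fd_gamma_upper _ hx
  · have hr := fdJ_rec m hm (2 * j)
    have e1 : (m + (2 * j : ℕ)) / 2 = m / 2 + j := by push_cast; ring
    have e2 : (m + (2 * j + 1 : ℕ)) / 2 = m / 2 + j + 1 / 2 := by push_cast; ring
    have hJ : fdJ m (2 * j + 1 + 1) = (2 * j + 1) / (2 * (m / 2 + j)) * fdJ m (2 * j) := by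
      have h3 : (2 * (m / 2 + j)) ≠ 0 := by positivity
      field_simp
      push_cast at hr
      linear_combination -hr
    rw [hJ, fdCoef, fdCoef, e1, e2, Nat.factorial_succ, pow_succ]
    have hk : ((2 * j).factorial : ℝ) ≠ 0 := by positivity
    push_cast
    field_simp
    ring

lemma fd_even_odd {f : ℕ → ℝ} (hf : Summable f) :
    ∑' k, f k = ∑' k, f (2 * k) + ∑' k, f (2 * k + 1) :=
  (tsum_even_add_odd (hf.comp_injective (i := fun k : ℕ => 2 * k) fun a b h => by simpa using h)
    (hf.comp_injective (i := fun k : ℕ => 2 * k + 1) fun a b h => by simpa using h)).symm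

lemma fisher_eq (n : ℕ) (ρ : ℝ) : ∃ K : ℝ, (3 ≤ n → ρ ∈ Set.Ioo (-1 : ℝ) 1 → 0 ≤ K) ∧
    fisherDensity n ρ = (Set.Ioo (-1 : ℝ) 1).indicator fun r =>
      K * (fdW ((n : ℝ) - 1) r * ∑' k, fdCoef ((n : ℝ) - 1) (2 * ρ) k * r ^ k) := by
  refine ⟨2 ^ ((n : ℝ) - 3) * (1 - ρ ^ 2) ^ (((n : ℝ) - 1) / 2) / (π * Gamma ((n : ℝ) - 2)),
    ?_, ?_⟩
  · intro hn hρ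
    have h1 := fdW_base hρ
    have h2 : (3 : ℝ) ≤ n := by exact_mod_cast hn
    have h3 := Gamma_pos_of_pos (show (0 : ℝ) < n - 2 by linarith)
    positivity
  · funext r
    by_cases hr : r ∈ Set.Ioo (-1 : ℝ) 1
    · rw [Set.indicator_of_mem hr, fisherDensity, if_pos (abs_lt.mpr hr)]
      have e : ∑' k : ℕ, (Gamma (((n : ℝ) - 1 + (k : ℝ)) / 2)) ^ 2 * (2 * r * ρ) ^ k /
          (Nat.factorial k : ℝ) = ∑' k, fdCoef ((n : ℝ) - 1) (2 * ρ) k * r ^ k := by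
        refine tsum_congr fun k => ?_
        rw [fdCoef, show 2 * r * ρ = 2 * ρ * r by ring, mul_pow (2 * ρ) r]
        ring
      have e2 : ((n : ℝ) - 4) / 2 = ((n : ℝ) - 1 - 3) / 2 := by ring
      rw [e, e2, fdW]
      ring
    · rw [Set.indicator_of_notMem hr, fisherDensity, if_neg (fun h => hr (abs_lt.mp h))]

lemma fd_mean {Ω : Type*} [MeasurableSpace Ω] (P : Measure Ω) [IsProbabilityMeasure P]
    (n : ℕ) (hn : 3 ≤ n) (ρ : ℝ) (hρ : ρ ∈ Set.Ioo (-1 : ℝ) 1)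
    (R : Ω → ℝ) (hR : Measurable R)
    (hlaw : Measure.map R P = volume.withDensity fun r => ENNReal.ofReal (fisherDensity n ρ r)) :
    ∃ c, 1 - 1 / (n : ℝ) ≤ c ∧ c ≤ 1 ∧ ∫ ω, R ω ∂P = c * ρ := by
  obtain ⟨K, hK, hf⟩ := fisher_eq n ρ
  replace hK := hK hn hρ
  have hn3 : (3 : ℝ) ≤ n := by exact_mod_cast hn
  obtain ⟨m, hmd⟩ : ∃ m : ℝ, m = (n : ℝ) - 1 := ⟨_, rfl⟩
  rw [← hmd] at hf
  have hm : 2 ≤ m := by linarith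
  have hy : |2 * ρ| < 2 := by
    rw [abs_lt]; constructor <;> linarith [hρ.1, hρ.2]
  set S : ℝ → ℝ := fun r => ∑' k, fdCoef m (2 * ρ) k * r ^ k with hS
  have hSnn : ∀ r ∈ Set.Ioo (-1 : ℝ) 1, 0 ≤ S r := by
    intro r hr
    have h1 : |r| < 1 := abs_lt.mpr hr
    have : S r = ∑' k, fdCoef m (2 * ρ * r) k := by
      refine tsum_congr fun k => ?_
      rw [fdCoef, fdCoef, mul_pow (2 * ρ) r]
      ring
    rw [this]
    refine fdSeries_nonneg m hm _ ?_
    rw [abs_mul]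
    nlinarith [abs_nonneg (2 * ρ), abs_nonneg r]
  have hfnn : ∀ r, 0 ≤ fisherDensity n ρ r := by
    intro r
    rw [hf]
    refine Set.indicator_nonneg (fun r hr => ?_) r
    exact mul_nonneg hK (mul_nonneg (fdW_nonneg m hr) (hSnn r hr))
  have hfm : AEMeasurable (fisherDensity n ρ) volume := by
    rw [hf, aemeasurable_indicator_iff measurableSet_Ioo]
    exact (continuousOn_const.mul
      ((fdW_cont m).mul (fd_series_cont m hm _ hy))).aemeasurable measurableSet_Ioo
  have hmom : ∀ e : ℕ, ∫ ω, (R ω) ^ e ∂P =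
      K * ∑' k, fdCoef m (2 * ρ) k * fdJ m (k + e) := by
    intro e
    have h1 : ∫ ω, (R ω) ^ e ∂P = ∫ r, r ^ e ∂(Measure.map R P) :=
      (integral_map hR.aemeasurable (continuous_pow e).aestronglyMeasurable).symm
    rw [h1, hlaw, integral_withDensity_eq_integral_toReal_smul₀ hfm.ennreal_ofReal
      (Filter.Eventually.of_forall fun r => ENNReal.ofReal_lt_top),
      (fd_moment m hm _ hy e).tsum_eq, ← integral_const_mul,
      ← integral_indicator measurableSet_Ioo]
    refine integral_congr_ae (Filter.Eventually.of_forall fun r => ?_)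
    simp only [ENNReal.toReal_ofReal (hfnn r), smul_eq_mul]
    rw [hf]
    by_cases hr : r ∈ Set.Ioo (-1 : ℝ) 1
    · rw [Set.indicator_of_mem hr, Set.indicator_of_mem hr]
      ring
    · rw [Set.indicator_of_notMem hr, Set.indicator_of_notMem hr, zero_mul]
  have h0 := hmom 0
  have h1 := hmom 1
  have s0 := (fd_moment m hm _ hy 0).summable
  have s1 := (fd_moment m hm _ hy 1).summable
  rw [fd_even_odd s0] at h0
  rw [fd_even_odd s1] at h1
  have z0 : ∀ k, fdJ m (2 * k + 1 + 0) = 0 := fun k => fdJ_odd m k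
  have z1 : ∀ k, fdJ m (2 * k + 1) = 0 := fun k => fdJ_odd m k
  simp only [z0, mul_zero, tsum_zero, add_zero, pow_zero, integral_const, probReal_univ,
    smul_eq_mul, mul_one] at h0
  simp only [z1, mul_zero, tsum_zero, zero_add, pow_one] at h1
  choose c hc1 hc2 hc3 using fdCoef_ratio m hm ρ
  simp only [hc3] at h1
  set d : ℕ → ℝ := fun j => fdCoef m (2 * ρ) (2 * j) * fdJ m (2 * j) with hd
  have hdn : ∀ j, 0 ≤ d j := by
    intro j
    refine mul_nonneg ?_ (fdJ_even_nonneg m j)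
    rw [fdCoef, pow_mul]
    positivity
  have hds : Summable d :=
    s0.comp_injective (i := fun k : ℕ => 2 * k) fun a b h => by simpa using h
  have hq : m / (m + 1) = 1 - 1 / (n : ℝ) := by
    have : (n : ℝ) = m + 1 := by linarith
    rw [this]
    field_simp
    ring
  have hq0 : 0 ≤ m / (m + 1) := by positivity
  have hcd : Summable fun j => c j * d j :=
    Summable.of_nonneg_of_le (fun j => mul_nonneg (hq0.trans (hc1 j)) (hdn j))
      (fun j => by nlinarith [hdn j, hc2 j]) hds
  refine ⟨K * ∑' j, c j * d j, ?_, ?_, ?_⟩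
  · rw [← hq]
    calc m / (m + 1) = K * ∑' j, m / (m + 1) * d j := by
          rw [tsum_mul_left]
          linear_combination (m / (m + 1)) * h0
      _ ≤ _ := by
          refine mul_le_mul_of_nonneg_left ?_ hK
          exact (hds.mul_left _).tsum_le_tsum
            (fun j => mul_le_mul_of_nonneg_right (hc1 j) (hdn j)) hcd
  · rw [h0]
    refine mul_le_mul_of_nonneg_left ?_ hK
    exact hcd.tsum_le_tsum (fun j => by nlinarith [hdn j, hc2 j]) hds
  · rw [h1, mul_assoc, ← tsum_mul_right]
    congr 1
    refine tsum_congr fun j => ?_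
    simp only [hd]
    ring

/-- Two-sided bounds for the mean of the sample correlation coefficient. -/
theorem mean_bounds {Ω : Type*} [MeasurableSpace Ω] (P : Measure Ω) [IsProbabilityMeasure P]
    (n : ℕ) (hn : 3 ≤ n) (ρ : ℝ) (hρ : ρ ∈ Set.Ioo (-1 : ℝ) 1)
    (R : Ω → ℝ) (hR : Measurable R)
    (hlaw : Measure.map R P = volume.withDensity fun r => ENNReal.ofReal (fisherDensity n ρ r)) :
    (0 ≤ ρ → (1 - 1 / (n : ℝ)) * ρ ≤ ∫ ω, R ω ∂P ∧ ∫ ω, R ω ∂P ≤ ρ) ∧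
      (ρ ≤ 0 → ρ ≤ ∫ ω, R ω ∂P ∧ ∫ ω, R ω ∂P ≤ (1 - 1 / (n : ℝ)) * ρ) ∧
      ((1 - 1 / (n : ℝ)) * |ρ| ≤ |∫ ω, R ω ∂P| ∧ |∫ ω, R ω ∂P| ≤ |ρ|) := by
  obtain ⟨c, h1, h2, h3⟩ := fd_mean P n hn ρ hρ R hR hlaw
  have hn3 : (3 : ℝ) ≤ n := by exact_mod_cast hn
  have hc : 0 ≤ c := by
    refine le_trans ?_ h1
    rw [sub_nonneg, div_le_one (by linarith)]
    linarith
  rw [h3, abs_mul, abs_of_nonneg hc]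
  refine ⟨fun h => ⟨?_, ?_⟩, fun h => ⟨?_, ?_⟩, ?_, ?_⟩
  · exact mul_le_mul_of_nonneg_right h1 h
  · nlinarith
  · nlinarith
  · exact mul_le_mul_of_nonpos_right h1 h
  · exact mul_le_mul_of_nonneg_right h1 (abs_nonneg ρ)
  · nlinarith [abs_nonneg ρ]
end
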